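/- arXiv:0906.1858 — 6 statements merged into one kernel-verified Lean document; each statement's English description precedes it below -/
import Mathlib

section
/- Let (V, V⁺, e_V) and (W, W⁺, e_W) be real AOU spaces. Then the injective tensor product V ⊗_ε W is a real AOU space: the injective cone (V ⊗_ε W)⁺ is a cone satisfying (V ⊗_ε W)⁺ ∩ −(V ⊗_ε W)⁺ = {0}, and e_V ⊗ e_W is an Archimedean order unit for it (for every z ∈ V ⊗ W there is r > 0 with r·(e_V ⊗ e_W) − z ∈ (V ⊗_ε W)⁺, and if z + ε·(e_V ⊗ e_W) ∈ (V ⊗_ε W)⁺ for all ε > 0 then z ∈ (V ⊗_ε W)⁺). -/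
open TensorProduct

/-- A real AOU space structure on a real vector space `V`: a proper cone together with
an Archimedean order unit. -/
structure AOU (V : Type*) [AddCommGroup V] [Module ℝ V] where
  pos : Set V
  unit : V
  zero_mem : (0 : V) ∈ pos
  add_mem : ∀ ⦃x y : V⦄, x ∈ pos → y ∈ pos → x + y ∈ pos
  smul_mem : ∀ ⦃r : ℝ⦄, 0 ≤ r → ∀ ⦃x : V⦄, x ∈ pos → r • x ∈ pos
  proper : ∀ x : V, x ∈ pos → -x ∈ pos → x = 0
  exists_orderUnit : ∀ v : V, ∃ r : ℝ, 0 < r ∧ r • unit - v ∈ pos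
  arch : ∀ v : V, (∀ ε : ℝ, 0 < ε → ε • unit + v ∈ pos) → v ∈ pos

variable {V W : Type*} [AddCommGroup V] [Module ℝ V] [AddCommGroup W] [Module ℝ W]

/-- A state on a real AOU space: a unital positive linear functional. -/
def IsState (A : AOU V) (f : V →ₗ[ℝ] ℝ) : Prop :=
  f A.unit = 1 ∧ ∀ v ∈ A.pos, 0 ≤ f v

/-- The tensor product functional `f ⊗ g` on `V ⊗ W`, with `(f ⊗ g)(v ⊗ w) = f v * g w`. -/
noncomputable def tensFun (f : V →ₗ[ℝ] ℝ) (g : W →ₗ[ℝ] ℝ) :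
    TensorProduct ℝ V W →ₗ[ℝ] ℝ :=
  TensorProduct.lift (f.smulRight g)

/-- The injective cone `(V ⊗_ε W)⁺`. -/
def injCone (A : AOU V) (B : AOU W) : Set (TensorProduct ℝ V W) :=
  {z | ∀ (f : V →ₗ[ℝ] ℝ) (g : W →ₗ[ℝ] ℝ), IsState A f → IsState B g → 0 ≤ tensFun f g z}

/-- The set `V⁺ ⊗ W⁺` of finite sums of elementary tensors of positive elements. -/
def simpleCone (A : AOU V) (B : AOU W) : Set (TensorProduct ℝ V W) :=
  {z | ∃ (n : ℕ) (v : Fin n → V) (w : Fin n → W),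
    (∀ i, v i ∈ A.pos) ∧ (∀ i, w i ∈ B.pos) ∧ z = ∑ i, v i ⊗ₜ[ℝ] w i}

/-- The projective cone `(V ⊗_π W)⁺`. -/
def projCone (A : AOU V) (B : AOU W) : Set (TensorProduct ℝ V W) :=
  {z | ∀ ε : ℝ, 0 < ε → z + ε • (A.unit ⊗ₜ[ℝ] B.unit) ∈ simpleCone A B}

/-- The order norm determined by a cone `pos` and order unit `e`. -/
noncomputable def gNorm {X : Type*} [AddCommGroup X] [Module ℝ X]
    (pos : Set X) (e : X) (x : X) : ℝ :=
  sInf {r : ℝ | 0 < r ∧ r • e - x ∈ pos ∧ r • e + x ∈ pos}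

theorem AOU.unit_mem (A : AOU V) : A.unit ∈ A.pos := by
  obtain ⟨r, hr, h⟩ := A.exists_orderUnit 0
  have h' := A.smul_mem (inv_nonneg.2 hr.le) h
  rwa [sub_zero, inv_smul_smul₀ hr.ne'] at h'

theorem AOU.unit_ne_zero (A : AOU V) {y : V} (hy : y ∉ A.pos) : A.unit ≠ 0 := by
  intro h
  obtain ⟨r, -, hr⟩ := A.exists_orderUnit (-y)
  simp only [h, smul_zero, zero_sub, neg_neg] at hr
  exact hy hr

/-- A vector outside the positive cone is sent to a nonpositive number by some state. -/
theorem AOU.exists_state_nonpos (A : AOU V) {y : V} (hy : y ∉ A.pos) :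
    ∃ f, IsState A f ∧ f y ≤ 0 := by
  let s : PointedCone ℝ V :=
    { carrier := {x | ∃ p ∈ A.pos, ∃ t : ℝ, 0 ≤ t ∧ x = p - t • y}
      zero_mem' := ⟨0, A.zero_mem, 0, le_rfl, by module⟩
      smul_mem' := by
        rintro ⟨c, hc⟩ _ ⟨p, hp, t, ht, rfl⟩
        refine ⟨c • p, A.smul_mem hc hp, c * t, mul_nonneg hc ht, ?_⟩
        change c • (p - t • y) = _
        module
      add_mem' := by
        rintro _ _ ⟨p, hp, t, ht, rfl⟩ ⟨q, hq, u, hu, rfl⟩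
        exact ⟨p + q, A.add_mem hp hq, t + u, by positivity, by module⟩ }
  have pos_le : ∀ p ∈ A.pos, p ∈ s := fun p hp => ⟨p, hp, 0, le_rfl, by module⟩
  have he := A.unit_ne_zero hy
  have unit_coeff_nonneg : ∀ c : ℝ, c • A.unit ∈ s → 0 ≤ c := by
    rintro c ⟨p, hp, t, ht, h⟩
    by_contra! hc
    have hmem := A.add_mem hp (A.smul_mem (neg_nonneg.2 hc.le) A.unit_mem)
    have hty : p + -c • A.unit = t • y := by
      rw [neg_smul, h]; abel
    rw [hty] at hmem
    rcases ht.eq_or_lt with rfl | ht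
    · have hpc : p = -((-c) • A.unit) := by
        rw [zero_smul] at hty
        exact eq_neg_of_add_eq_zero_left hty
      have := A.proper _ (A.smul_mem (neg_nonneg.2 hc.le) A.unit_mem) (hpc ▸ hp)
      rcases smul_eq_zero.1 this with h0 | h0
      · linarith
      · exact he h0
    · have h' := A.smul_mem (inv_nonneg.2 ht.le) hmem
      rw [inv_smul_smul₀ ht.ne'] at h'
      exact hy h'
  obtain ⟨g, hg, hpos⟩ := riesz_extension s (LinearPMap.mkSpanSingleton A.unit (1 : ℝ) he)
    (by
      rintro ⟨x, hx⟩ hxs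
      obtain ⟨c, rfl⟩ := Submodule.mem_span_singleton.1 hx
      refine (unit_coeff_nonneg c hxs).trans_eq ?_
      refine Eq.trans ?_ (LinearPMap.mkSpanSingleton'_apply A.unit (1 : ℝ) _ c hx).symm
      simp)
    (by
      intro v
      obtain ⟨r, -, hr⟩ := A.exists_orderUnit (-v)
      refine ⟨⟨r • A.unit, Submodule.mem_span_singleton.2 ⟨r, rfl⟩⟩, pos_le _ ?_⟩
      simpa using hr)
  refine ⟨g, ⟨?_, fun v hv => hpos v (pos_le v hv)⟩, ?_⟩
  · have h := hg ⟨A.unit, Submodule.mem_span_singleton_self _⟩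
    rwa [LinearPMap.mkSpanSingleton_apply] at h
  · have h := hpos (-y) ⟨0, A.zero_mem, 1, zero_le_one, by module⟩
    rw [map_neg] at h
    linarith

theorem AOU.mem_pos_of_forall_state (A : AOU V) {x : V}
    (h : ∀ f, IsState A f → 0 ≤ f x) : x ∈ A.pos := by
  refine A.arch x fun ε hε => ?_
  by_contra hy
  obtain ⟨f, hf, hle⟩ := A.exists_state_nonpos hy
  have := h f hf
  rw [map_add, map_smul, hf.1, smul_eq_mul] at hle
  linarith

/-- States separate the points of an AOU space. -/
theorem AOU.eq_zero_of_forall_state (A : AOU V) {x : V}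
    (h : ∀ f, IsState A f → f x = 0) : x = 0 :=
  A.proper x (A.mem_pos_of_forall_state fun f hf => (h f hf).ge)
    (A.mem_pos_of_forall_state fun f hf => by rw [map_neg, h f hf, neg_zero])

theorem AOU.exists_forall_state_abs_le (A : AOU V) (v : V) :
    ∃ r : ℝ, 0 < r ∧ ∀ f, IsState A f → |f v| ≤ r := by
  obtain ⟨r, hr, h⟩ := A.exists_orderUnit v
  obtain ⟨s, hs, h'⟩ := A.exists_orderUnit (-v)
  refine ⟨max r s, lt_max_of_lt_left hr, fun f hf => abs_le'.2 ⟨le_max_of_le_left ?_,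
    le_max_of_le_right ?_⟩⟩
  · have := hf.2 _ h
    rw [map_sub, map_smul, hf.1, smul_eq_mul] at this
    linarith
  · have := hf.2 _ h'
    rw [map_sub, map_smul, hf.1, smul_eq_mul, map_neg] at this
    linarith

@[simp]
theorem tensFun_tmul (f : V →ₗ[ℝ] ℝ) (g : W →ₗ[ℝ] ℝ) (v : V) (w : W) :
    tensFun f g (v ⊗ₜ[ℝ] w) = f v * g w := by
  simp [tensFun]

theorem tensFun_eq_apply_lid_rTensor (f : V →ₗ[ℝ] ℝ) (g : W →ₗ[ℝ] ℝ) (z : V ⊗[ℝ] W) :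
    tensFun f g z = g (TensorProduct.lid ℝ W (f.rTensor W z)) := by
  induction z with
  | zero => simp
  | tmul v w => simp
  | add x y hx hy => simp [hx, hy]

theorem tensFun_eq_apply_rid_lTensor (f : V →ₗ[ℝ] ℝ) (g : W →ₗ[ℝ] ℝ) (z : V ⊗[ℝ] W) :
    tensFun f g z = f (TensorProduct.rid ℝ V (g.lTensor V z)) := by
  induction z with
  | zero => simp
  | tmul v w => simp [mul_comm]
  | add x y hx hy => simp [hx, hy]

/-- Products of states separate the points of the algebraic tensor product. -/
theorem eq_zero_of_forall_tensFun (A : AOU V) (B : AOU W) {z : V ⊗[ℝ] W}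
    (h : ∀ f g, IsState A f → IsState B g → tensFun f g z = 0) : z = 0 := by
  have hslice : ∀ φ : V →ₗ[ℝ] ℝ, TensorProduct.lid ℝ W (φ.rTensor W z) = 0 := by
    refine fun φ => B.eq_zero_of_forall_state fun g hg => ?_
    have hz : TensorProduct.rid ℝ V (g.lTensor V z) = 0 :=
      A.eq_zero_of_forall_state fun f hf => by
        rw [← tensFun_eq_apply_rid_lTensor, h f g hf hg]
    rw [← tensFun_eq_apply_lid_rTensor, tensFun_eq_apply_rid_lTensor, hz, map_zero]
  classical
  let b := Module.Basis.ofVectorSpace ℝ V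
  refine (TensorProduct.equivFinsuppOfBasisLeft (N := W) b).injective ?_
  ext i
  rw [TensorProduct.equivFinsuppOfBasisLeft_apply, hslice, map_zero, Finsupp.zero_apply]

theorem exists_forall_tensFun_le (A : AOU V) (B : AOU W) (z : V ⊗[ℝ] W) :
    ∃ r : ℝ, 0 < r ∧ ∀ f g, IsState A f → IsState B g → tensFun f g z ≤ r := by
  induction z with
  | zero => exact ⟨1, one_pos, fun f g _ _ => by simp⟩
  | tmul v w =>
    obtain ⟨r, hr, hv⟩ := A.exists_forall_state_abs_le v
    obtain ⟨s, hs, hw⟩ := B.exists_forall_state_abs_le w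
    refine ⟨r * s, mul_pos hr hs, fun f g hf hg => ?_⟩
    rw [tensFun_tmul]
    refine (le_abs_self _).trans ?_
    rw [abs_mul]
    exact mul_le_mul (hv f hf) (hw g hg) (abs_nonneg _) hr.le
  | add x y hx hy =>
    obtain ⟨r, hr, hx⟩ := hx
    obtain ⟨s, hs, hy⟩ := hy
    refine ⟨r + s, add_pos hr hs, fun f g hf hg => ?_⟩
    rw [map_add]
    exact add_le_add (hx f g hf hg) (hy f g hf hg)

theorem tensFun_unit {A : AOU V} {B : AOU W} {f : V →ₗ[ℝ] ℝ} {g : W →ₗ[ℝ] ℝ}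
    (hf : IsState A f) (hg : IsState B g) :
    tensFun f g (A.unit ⊗ₜ[ℝ] B.unit) = 1 := by
  rw [tensFun_tmul, hf.1, hg.1, one_mul]

/-- the injective tensor product of two real AOU spaces is a real AOU space. -/
theorem injective_tensor_is_AOU (A : AOU V) (B : AOU W) :
    (0 : TensorProduct ℝ V W) ∈ injCone A B ∧
    (∀ x y : TensorProduct ℝ V W, x ∈ injCone A B → y ∈ injCone A B →
      x + y ∈ injCone A B) ∧
    (∀ r : ℝ, 0 ≤ r → ∀ x ∈ injCone A B, r • x ∈ injCone A B) ∧
    (∀ z : TensorProduct ℝ V W, z ∈ injCone A B → -z ∈ injCone A B → z = 0) ∧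
    (∀ z : TensorProduct ℝ V W, ∃ r : ℝ, 0 < r ∧
      r • (A.unit ⊗ₜ[ℝ] B.unit) - z ∈ injCone A B) ∧
    (∀ z : TensorProduct ℝ V W,
      (∀ ε : ℝ, 0 < ε → z + ε • (A.unit ⊗ₜ[ℝ] B.unit) ∈ injCone A B) →
      z ∈ injCone A B) := by
  refine ⟨fun f g _ _ => by rw [map_zero], fun x y hx hy f g hf hg => ?_,
    fun r hr x hx f g hf hg => ?_, fun z hz hz' => ?_, fun z => ?_, fun z hz f g hf hg => ?_⟩
  · rw [map_add]
    exact add_nonneg (hx f g hf hg) (hy f g hf hg)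
  · rw [map_smul]
    exact mul_nonneg hr (hx f g hf hg)
  · refine eq_zero_of_forall_tensFun A B fun f g hf hg => le_antisymm ?_ (hz f g hf hg)
    have := hz' f g hf hg
    rwa [map_neg, neg_nonneg] at this
  · obtain ⟨r, hr, h⟩ := exists_forall_tensFun_le A B z
    refine ⟨r, hr, fun f g hf hg => ?_⟩
    rw [map_sub, map_smul, tensFun_unit hf hg, smul_eq_mul, mul_one]
    exact sub_nonneg.2 (h f g hf hg)
  · refine le_of_forall_pos_le_add fun ε hε => ?_
    have := hz ε hε f g hf hg
    rwa [map_add, map_smul, tensFun_unit hf hg, smul_eq_mul, mul_one] at this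
end

section
/- Let (V, V⁺, e_V) and (W, W⁺, e_W) be real AOU spaces. Then the projective tensor product V ⊗_π W is a real AOU space: the projective cone (V ⊗_π W)⁺ is a cone satisfying (V ⊗_π W)⁺ ∩ −(V ⊗_π W)⁺ = {0}, and e_V ⊗ e_W is an Archimedean order unit for it (for every z ∈ V ⊗ W there is r > 0 with r·(e_V ⊗ e_W) − z ∈ (V ⊗_π W)⁺, and if z + ε·(e_V ⊗ e_W) ∈ (V ⊗_π W)⁺ for all ε > 0 then z ∈ (V ⊗_π W)⁺). -/
open TensorProduct

variable {V W : Type*} [AddCommGroup V] [Module ℝ V] [AddCommGroup W] [Module ℝ W]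

namespace AOU

theorem unit_mem_s1 (A : AOU V) : A.unit ∈ A.pos := by
  obtain ⟨r, hr, h⟩ := A.exists_orderUnit 0
  simpa [smul_smul, hr.ne'] using A.smul_mem (inv_nonneg.2 hr.le) h

theorem smul_unit_mem (A : AOU V) {r : ℝ} (hr : 0 ≤ r) : r • A.unit ∈ A.pos :=
  A.smul_mem hr A.unit_mem_s1

/-- Every vector is bounded on both sides by a common multiple of the order unit. -/
theorem exists_bound (A : AOU V) (v : V) :
    ∃ r : ℝ, 0 < r ∧ r • A.unit - v ∈ A.pos ∧ r • A.unit + v ∈ A.pos := by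
  obtain ⟨r, hr, h⟩ := A.exists_orderUnit v
  obtain ⟨s, hs, h'⟩ := A.exists_orderUnit (-v)
  refine ⟨r + s, by positivity, ?_, ?_⟩
  · convert A.add_mem h (A.smul_unit_mem hs.le) using 1
    module
  · convert A.add_mem h' (A.smul_unit_mem hr.le) using 1
    module

/-- The cone generated by the positive cone and `-u`. -/
def adjoinNeg (A : AOU V) (u : V) : PointedCone ℝ V where
  carrier := {x | ∃ r : ℝ, 0 ≤ r ∧ x + r • u ∈ A.pos}
  zero_mem' := ⟨0, le_rfl, by simpa using A.zero_mem⟩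
  add_mem' := by
    rintro x y ⟨r, hr, hx⟩ ⟨s, hs, hy⟩
    refine ⟨r + s, by positivity, ?_⟩
    convert A.add_mem hx hy using 1
    module
  smul_mem' := by
    rintro ⟨c, hc⟩ x ⟨r, hr, hx⟩
    refine ⟨c * r, by positivity, ?_⟩
    convert A.smul_mem hc hx using 1
    change c • x + (c * r) • u = c • (x + r • u)
    module

theorem mem_adjoinNeg (A : AOU V) {u x : V} :
    x ∈ A.adjoinNeg u ↔ ∃ r : ℝ, 0 ≤ r ∧ x + r • u ∈ A.pos := Iff.rfl

/-- A vector outside the positive cone takes a nonpositive value at some state. -/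
theorem exists_isState_nonpos (A : AOU V) {u : V} (hu : u ∉ A.pos) :
    ∃ f : V →ₗ[ℝ] ℝ, IsState A f ∧ f u ≤ 0 := by
  have he : A.unit ≠ 0 := by
    intro h
    obtain ⟨r, -, hr⟩ := A.exists_orderUnit (-u)
    exact hu (by simpa [h] using hr)
  obtain ⟨f, hf, hpos⟩ := riesz_extension (A.adjoinNeg u)
    (LinearPMap.mkSpanSingleton A.unit (1 : ℝ) he) (by
      rintro ⟨x, hx⟩ hxs
      obtain ⟨t, rfl⟩ := Submodule.mem_span_singleton.1 hx
      rw [LinearPMap.mkSpanSingleton'_apply]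
      obtain ⟨r, hr, hmem⟩ := A.mem_adjoinNeg.1 hxs
      by_contra! ht
      have ht' : t < 0 := by simpa using ht
      have hru : r • u ∈ A.pos := by
        convert A.add_mem hmem (A.smul_unit_mem (neg_nonneg.2 ht'.le)) using 1
        module
      rcases hr.eq_or_lt with rfl | hr
      · have h₁ : t • A.unit ∈ A.pos := by simpa using hmem
        have h₂ : -(t • A.unit) ∈ A.pos := by
          simpa using A.smul_unit_mem (neg_nonneg.2 ht'.le)
        exact (smul_ne_zero ht'.ne he) (A.proper _ h₁ h₂)
      · refine hu ?_
        simpa [smul_smul, hr.ne'] using A.smul_mem (inv_nonneg.2 hr.le) hru) (by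
      intro y
      obtain ⟨r, -, -, h⟩ := A.exists_bound y
      exact ⟨⟨r • A.unit, Submodule.smul_mem _ _ (Submodule.mem_span_singleton_self _)⟩,
        A.mem_adjoinNeg.2 ⟨0, le_rfl, by simpa using h⟩⟩)
  refine ⟨f, ⟨?_, fun v hv ↦ hpos v (A.mem_adjoinNeg.2 ⟨0, le_rfl, by simpa using hv⟩)⟩, ?_⟩
  · have h := hf ⟨A.unit, Submodule.mem_span_singleton_self _⟩
    rwa [LinearPMap.mkSpanSingleton_apply ℝ ℝ he] at h
  · have h := hpos (-u) (A.mem_adjoinNeg.2 ⟨1, zero_le_one, by simpa using A.zero_mem⟩)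
    simpa using h

/-- The positive cone is determined by the states. -/
theorem mem_pos_of_isState_nonneg (A : AOU V) {v : V}
    (h : ∀ f : V →ₗ[ℝ] ℝ, IsState A f → 0 ≤ f v) : v ∈ A.pos := by
  refine A.arch v fun ε hε ↦ ?_
  by_contra hu
  obtain ⟨f, hf, hfu⟩ := A.exists_isState_nonpos hu
  have := h f hf
  simp only [map_add, map_smul, hf.1, smul_eq_mul, mul_one] at hfu
  linarith

/-- The states separate points. -/
theorem eq_zero_of_isState_eq_zero (A : AOU V) {v : V}
    (h : ∀ f : V →ₗ[ℝ] ℝ, IsState A f → f v = 0) : v = 0 :=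
  A.proper v (A.mem_pos_of_isState_nonneg fun f hf ↦ (h f hf).ge)
    (A.mem_pos_of_isState_nonneg fun f hf ↦ by simp [h f hf])

end AOU

/-- The tensor products of states separate points. -/
theorem eq_zero_of_tensFun_eq_zero (A : AOU V) (B : AOU W) {z : V ⊗[ℝ] W}
    (h : ∀ (f : V →ₗ[ℝ] ℝ) (g : W →ₗ[ℝ] ℝ), IsState A f → IsState B g → tensFun f g z = 0) :
    z = 0 := by
  classical
  have hslice : ∀ f : V →ₗ[ℝ] ℝ, IsState A f →
      TensorProduct.lid ℝ W (f.rTensor W z) = 0 := by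
    intro f hf
    refine B.eq_zero_of_isState_eq_zero fun g hg ↦ ?_
    rw [← h f g hf hg]
    clear h
    induction z using TensorProduct.induction_on with
    | zero => simp
    | tmul v w => simp
    | add x y hx hy => simp only [map_add, hx, hy]
  let b := Module.Basis.ofVectorSpace ℝ W
  refine (TensorProduct.equivFinsuppOfBasisRight (M := V) b).map_eq_zero_iff.1 ?_
  ext i
  refine A.eq_zero_of_isState_eq_zero fun f hf ↦ ?_
  trans b.repr (TensorProduct.lid ℝ W (f.rTensor W z)) i
  · clear hslice h
    induction z using TensorProduct.induction_on with
    | zero => simp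
    | tmul v w => simp [mul_comm]
    | add x y hx hy => simp only [map_add, Finsupp.add_apply, hx, hy]
  · simp [hslice f hf]

section Cones

variable (A : AOU V) (B : AOU W)

theorem zero_mem_simpleCone : (0 : V ⊗[ℝ] W) ∈ simpleCone A B :=
  ⟨0, Fin.elim0, Fin.elim0, fun i ↦ i.elim0, fun i ↦ i.elim0, by simp⟩

variable {A B}

theorem tmul_mem_simpleCone {v : V} {w : W} (hv : v ∈ A.pos) (hw : w ∈ B.pos) :
    v ⊗ₜ[ℝ] w ∈ simpleCone A B :=
  ⟨1, fun _ ↦ v, fun _ ↦ w, fun _ ↦ hv, fun _ ↦ hw, by simp⟩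

theorem add_mem_simpleCone {x y : V ⊗[ℝ] W} (hx : x ∈ simpleCone A B)
    (hy : y ∈ simpleCone A B) : x + y ∈ simpleCone A B := by
  obtain ⟨m, v, w, hv, hw, rfl⟩ := hx
  obtain ⟨n, v', w', hv', hw', rfl⟩ := hy
  refine ⟨m + n, Fin.append v v', Fin.append w w', fun i ↦ ?_, fun i ↦ ?_, ?_⟩
  · refine Fin.addCases (fun j ↦ ?_) (fun j ↦ ?_) i
    · simpa using hv j
    · simpa using hv' j
  · refine Fin.addCases (fun j ↦ ?_) (fun j ↦ ?_) i
    · simpa using hw j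
    · simpa using hw' j
  · simp [Fin.sum_univ_add]

theorem smul_mem_simpleCone {r : ℝ} (hr : 0 ≤ r) {x : V ⊗[ℝ] W} (hx : x ∈ simpleCone A B) :
    r • x ∈ simpleCone A B := by
  obtain ⟨n, v, w, hv, hw, rfl⟩ := hx
  exact ⟨n, fun i ↦ r • v i, w, fun i ↦ A.smul_mem hr (hv i), hw, by
    simp [Finset.smul_sum, TensorProduct.smul_tmul']⟩

theorem unit_tmul_unit_mem_simpleCone : A.unit ⊗ₜ[ℝ] B.unit ∈ simpleCone A B :=
  tmul_mem_simpleCone A.unit_mem_s1 B.unit_mem_s1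

theorem simpleCone_subset_projCone : simpleCone A B ⊆ projCone A B :=
  fun _ hz _ hε ↦ add_mem_simpleCone hz (smul_mem_simpleCone hε.le unit_tmul_unit_mem_simpleCone)

theorem tensFun_nonneg_of_mem_simpleCone {f : V →ₗ[ℝ] ℝ} {g : W →ₗ[ℝ] ℝ} (hf : IsState A f)
    (hg : IsState B g) {z : V ⊗[ℝ] W} (hz : z ∈ simpleCone A B) : 0 ≤ tensFun f g z := by
  obtain ⟨n, v, w, hv, hw, rfl⟩ := hz
  simp only [map_sum, tensFun_tmul]
  exact Finset.sum_nonneg fun i _ ↦ mul_nonneg (hf.2 _ (hv i)) (hg.2 _ (hw i))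

theorem projCone_subset_injCone : projCone A B ⊆ injCone A B := by
  intro z hz f g hf hg
  refine le_of_forall_pos_le_add fun ε hε ↦ ?_
  simpa [hf.1, hg.1] using tensFun_nonneg_of_mem_simpleCone hf hg (hz ε hε)

variable (A B) in
theorem exists_smul_unit_sub_mem_simpleCone (z : V ⊗[ℝ] W) :
    ∃ r : ℝ, 0 < r ∧ r • (A.unit ⊗ₜ[ℝ] B.unit) - z ∈ simpleCone A B := by
  induction z using TensorProduct.induction_on with
  | zero => exact ⟨1, one_pos, by simpa using unit_tmul_unit_mem_simpleCone⟩
  | tmul v w =>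
    obtain ⟨a, ha, hav, hav'⟩ := A.exists_bound v
    obtain ⟨b, hb, hbw, hbw'⟩ := B.exists_bound w
    refine ⟨a * b, by positivity, ?_⟩
    convert smul_mem_simpleCone (r := 1 / 2) (by norm_num)
      (add_mem_simpleCone (tmul_mem_simpleCone hav hbw') (tmul_mem_simpleCone hav' hbw)) using 1
    simp only [TensorProduct.add_tmul, TensorProduct.sub_tmul, TensorProduct.tmul_add,
      TensorProduct.tmul_sub, TensorProduct.tmul_smul, ← TensorProduct.smul_tmul']
    module
  | add x y hx hy =>
    obtain ⟨r, hr, hx⟩ := hx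
    obtain ⟨s, hs, hy⟩ := hy
    refine ⟨r + s, by positivity, ?_⟩
    convert add_mem_simpleCone hx hy using 1
    module

end Cones

/-- the projective tensor product of two real AOU spaces is a real AOU space. -/
theorem projective_tensor_is_AOU (A : AOU V) (B : AOU W) :
    (0 : TensorProduct ℝ V W) ∈ projCone A B ∧
    (∀ x y : TensorProduct ℝ V W, x ∈ projCone A B → y ∈ projCone A B →
      x + y ∈ projCone A B) ∧
    (∀ r : ℝ, 0 ≤ r → ∀ x ∈ projCone A B, r • x ∈ projCone A B) ∧
    (∀ z : TensorProduct ℝ V W, z ∈ projCone A B → -z ∈ projCone A B → z = 0) ∧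
    (∀ z : TensorProduct ℝ V W, ∃ r : ℝ, 0 < r ∧
      r • (A.unit ⊗ₜ[ℝ] B.unit) - z ∈ projCone A B) ∧
    (∀ z : TensorProduct ℝ V W,
      (∀ ε : ℝ, 0 < ε → z + ε • (A.unit ⊗ₜ[ℝ] B.unit) ∈ projCone A B) →
      z ∈ projCone A B) := by
  refine ⟨simpleCone_subset_projCone (zero_mem_simpleCone A B), ?_, ?_, ?_, ?_, ?_⟩
  · intro x y hx hy ε hε
    convert add_mem_simpleCone (hx (ε / 2) (by positivity)) (hy (ε / 2) (by positivity)) using 1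
    module
  · intro r hr x hx ε hε
    rcases hr.eq_or_lt with rfl | hr
    · simpa using smul_mem_simpleCone hε.le (unit_tmul_unit_mem_simpleCone (A := A) (B := B))
    · convert smul_mem_simpleCone hr.le (hx (ε / r) (by positivity)) using 1
      rw [smul_add, smul_smul, mul_div_cancel₀ _ hr.ne']
  · intro z hz hz'
    refine eq_zero_of_tensFun_eq_zero A B fun f g hf hg ↦ le_antisymm ?_ ?_
    · simpa using projCone_subset_injCone hz' f g hf hg
    · exact projCone_subset_injCone hz f g hf hg
  · intro z
    obtain ⟨r, hr, h⟩ := exists_smul_unit_sub_mem_simpleCone A B z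
    exact ⟨r, hr, simpleCone_subset_projCone h⟩
  · intro z hz ε hε
    convert hz (ε / 2) (by positivity) (ε / 2) (by positivity) using 1
    module
end

section
/- Let V, W and Z be real AOU spaces and let Φ : V × W → Z be a bilinear map such that Φ(e_V, e_W) = e_Z and Φ(v, w) ∈ Z⁺ for all v ∈ V⁺ and w ∈ W⁺. Then there exists a unique unital positive linear map Φ̃ : V ⊗_π W → Z (positive with respect to the projective cone) such that Φ̃(v ⊗ w) = Φ(v, w) for all v ∈ V, w ∈ W. -/
open TensorProduct

variable {V W : Type*} [AddCommGroup V] [Module ℝ V] [AddCommGroup W] [Module ℝ W]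

/-- The positive cone of an AOU space is closed under finite sums. -/
theorem AOU.sum_mem (A : AOU V) {ι : Type*} (s : Finset ι) (x : ι → V)
    (hx : ∀ i ∈ s, x i ∈ A.pos) : ∑ i ∈ s, x i ∈ A.pos :=
  Finset.sum_induction x (· ∈ A.pos) (fun _ _ ha hb => A.add_mem ha hb) A.zero_mem hx

/-- The linearization of a bilinear map that is positive on products of positive elements
is positive on `V⁺ ⊗ W⁺`. -/
theorem lift_mem_pos_of_mem_simpleCone {Z : Type*} [AddCommGroup Z] [Module ℝ Z]
    {A : AOU V} {B : AOU W} {C : AOU Z} {Φ : V →ₗ[ℝ] W →ₗ[ℝ] Z}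
    (hΦ : ∀ v ∈ A.pos, ∀ w ∈ B.pos, Φ v w ∈ C.pos)
    {z : TensorProduct ℝ V W} (hz : z ∈ simpleCone A B) :
    TensorProduct.lift Φ z ∈ C.pos := by
  obtain ⟨n, v, w, hv, hw, rfl⟩ := hz
  simp only [map_sum, TensorProduct.lift.tmul]
  exact C.sum_mem _ _ fun i _ => hΦ _ (hv i) _ (hw i)

/-- universal property of the projective tensor product of real AOU spaces. -/
theorem projective_tensor_universal_property
    {Z : Type*} [AddCommGroup Z] [Module ℝ Z]
    (A : AOU V) (B : AOU W) (C : AOU Z)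
    (Φ : V →ₗ[ℝ] W →ₗ[ℝ] Z)
    (hΦunit : Φ A.unit B.unit = C.unit)
    (hΦpos : ∀ v ∈ A.pos, ∀ w ∈ B.pos, Φ v w ∈ C.pos) :
    ∃! Φt : TensorProduct ℝ V W →ₗ[ℝ] Z,
      Φt (A.unit ⊗ₜ[ℝ] B.unit) = C.unit ∧
      (∀ z ∈ projCone A B, Φt z ∈ C.pos) ∧
      (∀ (v : V) (w : W), Φt (v ⊗ₜ[ℝ] w) = Φ v w) := by
  refine ⟨TensorProduct.lift Φ, ⟨by simpa using hΦunit, fun z hz => ?_, fun v w => by simp⟩, ?_⟩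
  · refine C.arch _ fun ε hε => ?_
    have h := lift_mem_pos_of_mem_simpleCone hΦpos (hz ε hε)
    rwa [map_add, map_smul, TensorProduct.lift.tmul, hΦunit, add_comm] at h
  · rintro Ψ ⟨-, -, hΨ⟩
    exact TensorProduct.ext' fun v w => by simp [hΨ]
end

section
/- Let T : V → W be a unital positive linear map between real AOU spaces. Then T is an order embedding (i.e. for every v ∈ V, v ∈ V⁺ if and only if T(v) ∈ W⁺) if and only if T is an isometry with respect to the order norms of V and W (i.e. ‖T(v)‖ = ‖v‖ for all v ∈ V). -/
open TensorProduct

variable {V W : Type*} [AddCommGroup V] [Module ℝ V] [AddCommGroup W] [Module ℝ W]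

/-- Any real number above the order norm of `v` dominates `-v`. -/
theorem AOU.smul_unit_add_mem_of_gNorm_lt (A : AOU V) {v : V} {r : ℝ}
    (h : gNorm A.pos A.unit v < r) : r • A.unit + v ∈ A.pos := by
  obtain ⟨a, ha, hav⟩ := A.exists_orderUnit v
  obtain ⟨b, hb, hbv⟩ := A.exists_orderUnit (-v)
  have hne : {r : ℝ | 0 < r ∧ r • A.unit - v ∈ A.pos ∧ r • A.unit + v ∈ A.pos}.Nonempty := by
    refine ⟨a + b, by positivity, ?_, ?_⟩
    · convert A.add_mem hav (A.smul_mem hb.le A.unit_mem) using 1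
      module
    · convert A.add_mem hbv (A.smul_mem ha.le A.unit_mem) using 1
      module
  obtain ⟨s, ⟨-, -, hs⟩, hsr⟩ := exists_lt_of_csInf_lt hne h
  convert A.add_mem hs (A.smul_mem (sub_nonneg.mpr hsr.le) A.unit_mem) using 1
  module

/-- If `-r • e ≤ v ≤ r • e` with `r` positive then the order norm of `v` is at most `r`. -/
theorem gNorm_le {X : Type*} [AddCommGroup X] [Module ℝ X] {pos : Set X} {e x : X} {r : ℝ}
    (hr : 0 < r) (h₁ : r • e - x ∈ pos) (h₂ : r • e + x ∈ pos) : gNorm pos e x ≤ r :=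
  csInf_le ⟨0, fun _ hs => hs.1.le⟩ ⟨hr, h₁, h₂⟩

/-- a unital positive map between real AOU spaces is an order embedding
if and only if it is an isometry for the order norms. -/
theorem orderEmbedding_iff_isometry (A : AOU V) (B : AOU W) (T : V →ₗ[ℝ] W)
    (hu : T A.unit = B.unit) (hp : ∀ v ∈ A.pos, T v ∈ B.pos) :
    (∀ v : V, v ∈ A.pos ↔ T v ∈ B.pos) ↔
    (∀ v : V, gNorm B.pos B.unit (T v) = gNorm A.pos A.unit v) := by
  constructor
  · intro h v
    simp only [gNorm, h, map_sub, map_add, map_smul, hu]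
  · refine fun h v => ⟨hp v, fun hv => A.arch v fun ε hε => ?_⟩
    obtain ⟨r, hr, hrv⟩ := A.exists_orderUnit v
    have hle : gNorm A.pos A.unit (v - (r / 2) • A.unit) ≤ r / 2 := by
      rw [← h]
      refine gNorm_le (by positivity) ?_ ?_
      · convert hp _ hrv using 1
        simp only [map_sub, map_smul, hu]
        module
      · convert hv using 1
        simp only [map_sub, map_smul, hu]
        module
    convert A.smul_unit_add_mem_of_gNorm_lt (hle.trans_lt (lt_add_of_pos_right _ hε)) using 1
    module
end

section
/- Let T : V → W be a unital positive linear map between real AOU spaces. If T is a quotient map with respect to the order norms (i.e. T maps the open unit ball { v ∈ V : ‖v‖ < 1 } onto the open unit ball { w ∈ W : ‖w‖ < 1 }), then T is an order quotient map: for every w ∈ W⁺ and every ε > 0 there exists v ∈ V with v + ε·e_V ∈ V⁺ and T(v) = w. -/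
open TensorProduct

variable {V W : Type*} [AddCommGroup V] [Module ℝ V] [AddCommGroup W] [Module ℝ W]

namespace AOU

variable {X : Type*} [AddCommGroup X] [Module ℝ X] (C : AOU X)

theorem unit_mem_pos : C.unit ∈ C.pos := by
  obtain ⟨r, hr, h⟩ := C.exists_orderUnit 0
  have h' := C.smul_mem (inv_nonneg.2 hr.le) h
  rwa [sub_zero, smul_smul, inv_mul_cancel₀ hr.ne', one_smul] at h'

theorem smul_unit_mem_pos {r : ℝ} (hr : 0 ≤ r) : r • C.unit ∈ C.pos :=
  C.smul_mem hr C.unit_mem_pos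

theorem gNorm_le {x : X} {r : ℝ} (hr : 0 < r) (h₁ : r • C.unit - x ∈ C.pos)
    (h₂ : r • C.unit + x ∈ C.pos) : gNorm C.pos C.unit x ≤ r :=
  csInf_le ⟨0, fun _ hs => hs.1.le⟩ ⟨hr, h₁, h₂⟩

theorem add_mem_pos_of_gNorm_lt {x : X} {r : ℝ} (h : gNorm C.pos C.unit x < r) :
    r • C.unit + x ∈ C.pos := by
  obtain ⟨a, ha, hxa⟩ := C.exists_orderUnit x
  obtain ⟨b, hb, hxb⟩ := C.exists_orderUnit (-x)
  have hne : {s : ℝ | 0 < s ∧ s • C.unit - x ∈ C.pos ∧ s • C.unit + x ∈ C.pos}.Nonempty := by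
    refine ⟨a + b, add_pos ha hb, ?_, ?_⟩
    · convert C.add_mem hxa (C.smul_unit_mem_pos hb.le) using 1
      module
    · convert C.add_mem hxb (C.smul_unit_mem_pos ha.le) using 1
      module
  obtain ⟨s, ⟨-, -, hs⟩, hsr⟩ := exists_lt_of_csInf_lt hne h
  convert C.add_mem hs (C.smul_unit_mem_pos (sub_nonneg.2 hsr.le)) using 1
  module

end AOU

/-- a unital positive map which is a quotient map for the order norms is
an order quotient map. -/
theorem quotient_map_is_order_quotient (A : AOU V) (B : AOU W) (T : V →ₗ[ℝ] W)
    (hu : T A.unit = B.unit) (hp : ∀ v ∈ A.pos, T v ∈ B.pos)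
    (hq : T '' {v : V | gNorm A.pos A.unit v < 1} = {w : W | gNorm B.pos B.unit w < 1}) :
    ∀ w ∈ B.pos, ∀ ε : ℝ, 0 < ε → ∃ v : V, v + ε • A.unit ∈ A.pos ∧ T v = w := by
  intro w hw ε hε
  obtain ⟨R, hR, hRw⟩ := B.exists_orderUnit w
  have ht : 0 < R / 2 + ε := by positivity
  set t := R / 2 + ε with htdef
  have hx : gNorm B.pos B.unit (t⁻¹ • (w - (R / 2) • B.unit)) < 1 := by
    have hlt : t⁻¹ * (R / 2) < 1 := by
      rw [inv_mul_lt_one₀ ht]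
      linarith
    refine (B.gNorm_le (by positivity) ?_ ?_).trans_lt hlt
    · convert B.smul_mem (inv_nonneg.2 ht.le) hRw using 1
      module
    · convert B.smul_mem (inv_nonneg.2 ht.le) hw using 1
      module
  obtain ⟨u, hu1, hTu⟩ := hq.ge hx
  refine ⟨t • u + (R / 2) • A.unit, ?_, ?_⟩
  · convert A.smul_mem ht.le (A.add_mem_pos_of_gNorm_lt hu1) using 1
    rw [htdef]
    module
  · rw [map_add, map_smul, map_smul, hTu, hu, smul_inv_smul₀ ht.ne', sub_add_cancel]
end

section
/- Let V₁, V₂, W be real AOU spaces and let ι : V₁ → V₂ be a unital order embedding (ι is linear, ι(e_{V₁}) = e_{V₂}, and for every v ∈ V₁, v ∈ V₁⁺ if and only if ι(v) ∈ V₂⁺). Then ι ⊗ id_W : V₁ ⊗ W → V₂ ⊗ W is a unital order embedding with respect to the injective cones: for every z ∈ V₁ ⊗ W, z ∈ (V₁ ⊗_ε W)⁺ if and only if (ι ⊗ id_W)(z) ∈ (V₂ ⊗_ε W)⁺. -/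
open TensorProduct

variable {V W : Type*} [AddCommGroup V] [Module ℝ V] [AddCommGroup W] [Module ℝ W]

theorem tensFun_map {V₁ V₂ W₁ W₂ : Type*}
    [AddCommGroup V₁] [Module ℝ V₁] [AddCommGroup V₂] [Module ℝ V₂]
    [AddCommGroup W₁] [Module ℝ W₁] [AddCommGroup W₂] [Module ℝ W₂]
    (i : V₁ →ₗ[ℝ] V₂) (j : W₁ →ₗ[ℝ] W₂) (f : V₂ →ₗ[ℝ] ℝ) (g : W₂ →ₗ[ℝ] ℝ)
    (z : TensorProduct ℝ V₁ W₁) :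
    tensFun f g (TensorProduct.map i j z) = tensFun (f ∘ₗ i) (g ∘ₗ j) z := by
  suffices h : tensFun f g ∘ₗ TensorProduct.map i j = tensFun (f ∘ₗ i) (g ∘ₗ j) from
    LinearMap.congr_fun h z
  ext v w
  simp [tensFun]

/-- The positive cone of a real AOU space as a pointed cone. -/
def AOU.cone (A : AOU V) : PointedCone ℝ V where
  carrier := A.pos
  zero_mem' := A.zero_mem
  add_mem' := fun hx hy => A.add_mem hx hy
  smul_mem' := fun c _ hx => A.smul_mem c.2 hx

/-- States extend along unital order embeddings. -/
theorem IsState.exists_extension {V₁ V₂ : Type*}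
    [AddCommGroup V₁] [Module ℝ V₁] [AddCommGroup V₂] [Module ℝ V₂]
    {A₁ : AOU V₁} {A₂ : AOU V₂} {ι : V₁ →ₗ[ℝ] V₂}
    (hu : ι A₁.unit = A₂.unit) (hemb : ∀ v : V₁, v ∈ A₁.pos ↔ ι v ∈ A₂.pos)
    {f : V₁ →ₗ[ℝ] ℝ} (hf : IsState A₁ f) :
    ∃ g : V₂ →ₗ[ℝ] ℝ, IsState A₂ g ∧ g ∘ₗ ι = f := by
  have hinj : Function.Injective ι := by
    refine (injective_iff_map_eq_zero ι).2 fun v hv => A₁.proper v ?_ ?_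
    · rw [hemb, hv]
      exact A₂.zero_mem
    · rw [hemb, map_neg, hv, neg_zero]
      exact A₂.zero_mem
  let e := LinearEquiv.ofInjective ι hinj
  obtain ⟨g, hgf, hg⟩ := riesz_extension A₂.cone ⟨LinearMap.range ι, f ∘ₗ e.symm.toLinearMap⟩
    (fun x hx => by
      obtain ⟨v, rfl⟩ := e.surjective x
      have hv : 0 ≤ f v := hf.2 v ((hemb v).2 hx)
      simpa using! hv)
    (fun y => by
      obtain ⟨r, -, hr⟩ := A₂.exists_orderUnit (-y)
      refine ⟨e (r • A₁.unit), ?_⟩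
      have h : ((e (r • A₁.unit) : LinearMap.range ι) : V₂) = r • A₂.unit := by
        simp [e, hu]
      rw [sub_neg_eq_add] at hr
      rw [h]
      exact hr)
  have hgι : ∀ v, g (ι v) = f v := fun v =>
    (hgf (e v)).trans (congrArg f (e.symm_apply_apply v))
  exact ⟨g, ⟨by rw [← hu, hgι, hf.1], hg⟩, LinearMap.ext hgι⟩

/-- the injective tensor product with a fixed real AOU space preserves
unital order embeddings. -/
theorem injective_tensor_preserves_embedding
    {V₁ V₂ : Type*}
    [AddCommGroup V₁] [Module ℝ V₁] [AddCommGroup V₂] [Module ℝ V₂]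
    (A₁ : AOU V₁) (A₂ : AOU V₂) (B : AOU W)
    (ι : V₁ →ₗ[ℝ] V₂)
    (hu : ι A₁.unit = A₂.unit)
    (hemb : ∀ v : V₁, v ∈ A₁.pos ↔ ι v ∈ A₂.pos) :
    TensorProduct.map ι (LinearMap.id : W →ₗ[ℝ] W) (A₁.unit ⊗ₜ[ℝ] B.unit)
      = A₂.unit ⊗ₜ[ℝ] B.unit ∧
    ∀ z : TensorProduct ℝ V₁ W,
      z ∈ injCone A₁ B ↔
        TensorProduct.map ι (LinearMap.id : W →ₗ[ℝ] W) z ∈ injCone A₂ B := by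
  refine ⟨by simp [hu], fun z => ⟨fun hz f g hf hg => ?_, fun hz f g hf hg => ?_⟩⟩
  · rw [tensFun_map]
    exact hz _ _ ⟨by simpa [hu] using hf.1, fun v hv => hf.2 _ ((hemb v).1 hv)⟩ hg
  · obtain ⟨f', hf', rfl⟩ := hf.exists_extension hu hemb
    have h := hz f' g hf' hg
    rwa [tensFun_map] at h
end
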